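/- Let d ≥ 1, s ∈ ℝ, τ ≥ 0, N ≥ 1 a natural number, q, B, L ≥ 0, let W be a nonempty set, and let J : W × (ℤ^d → ℝ) → ℝ satisfy |J(w,u) − J(w,u')| ≤ L · (∑_n w_{s−τ}(n)(u(n) − u'(n))²)^{1/2} for all w ∈ W and all u, u' with finite (s−τ)-norm, with w ↦ J(w,v) bounded below on W for every v. Let g, u : ℤ^d → ℝ with g(n) = 0 for ‖n‖_∞ > N, ∑_{‖n‖_∞ ≤ N} w_{s−τ}(n)(g(n) − u(n))² ≤ q, and ∑_n w_s(n) u(n)² ≤ B. Let V := { v : ℤ^d → ℝ | v(n) = 0 for ‖n‖_∞ > N, ∑_{‖n‖_∞ ≤ N} w_{s−τ}(n)(g(n) − v(n))² ≤ q, and ∑_n w_s(n) v(n)² ≤ B } (so that the truncation of u belongs to V). Then | inf_{w∈W} sup_{v∈V} J(w,v) − inf_{w∈W} J(w,u) | ≤ L · √(4q + B · N^{−2τ}). -/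

import Mathlib

open scoped BigOperators

/-- Squared Euclidean norm of a lattice point `n ∈ ℤ^d`, viewed in `ℝ^d`. -/
noncomputable def latNormSq {d : ℕ} (n : Fin d → ℤ) : ℝ := ∑ i, ((n i : ℝ)) ^ 2

/-- Sobolev weight `w_r(n) = (1 + ‖n‖₂²)^r`. -/
noncomputable def sobWeight {d : ℕ} (r : ℝ) (n : Fin d → ℤ) : ℝ := (1 + latNormSq n) ^ r

/-- Max (sup) norm `‖n‖_∞` of a lattice point, as a natural number. -/
def supNorm {d : ℕ} (n : Fin d → ℤ) : ℕ := Finset.univ.sup fun i => (n i).natAbs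

theorem latNormSq_nonneg {d : ℕ} (n : Fin d → ℤ) : 0 ≤ latNormSq n :=
  Finset.sum_nonneg fun _ _ => sq_nonneg _

theorem sobWeight_nonneg {d : ℕ} (r : ℝ) (n : Fin d → ℤ) : 0 ≤ sobWeight r n :=
  Real.rpow_nonneg (by linarith [latNormSq_nonneg n]) r

theorem finite_setOf_supNorm_le (d N : ℕ) : {n : Fin d → ℤ | supNorm n ≤ N}.Finite := by
  refine (Set.finite_Icc (fun _ : Fin d => -(N : ℤ)) (fun _ => (N : ℤ))).subset ?_
  intro n hn
  have h : ∀ i, (n i).natAbs ≤ N := fun i =>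
    (Finset.le_sup (f := fun i => (n i).natAbs) (Finset.mem_univ i)).trans hn
  exact ⟨fun i => by have := h i; dsimp only; omega, fun i => by have := h i; dsimp only; omega⟩

theorem sq_le_latNormSq_of_lt_supNorm {d N : ℕ} {n : Fin d → ℤ} (hn : N < supNorm n) :
    (N : ℝ) ^ 2 ≤ latNormSq n := by
  obtain ⟨i, -, hi⟩ := Finset.lt_sup_iff.1 hn
  have h : (N : ℝ) ≤ |(n i : ℝ)| := by
    rw [← Int.cast_abs, Int.abs_eq_natAbs]
    exact_mod_cast hi.le
  calc (N : ℝ) ^ 2 ≤ |(n i : ℝ)| ^ 2 := by gcongr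
    _ = (n i : ℝ) ^ 2 := sq_abs _
    _ ≤ latNormSq n := Finset.single_le_sum (f := fun i => (n i : ℝ) ^ 2)
        (fun _ _ => sq_nonneg _) (Finset.mem_univ i)

theorem sobWeight_sub_le {d : ℕ} (s : ℝ) {τ : ℝ} (hτ : 0 ≤ τ) (n : Fin d → ℤ) :
    sobWeight (s - τ) n ≤ sobWeight s n :=
  Real.rpow_le_rpow_of_exponent_le (by linarith [latNormSq_nonneg n]) (by linarith)

theorem sobWeight_sub_le_of_lt_supNorm {d N : ℕ} (hN : 1 ≤ N) (s : ℝ) {τ : ℝ} (hτ : 0 ≤ τ)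
    {n : Fin d → ℤ} (hn : N < supNorm n) :
    sobWeight (s - τ) n ≤ (N : ℝ) ^ (-(2 * τ)) * sobWeight s n := by
  have hN' : (0 : ℝ) < N := by exact_mod_cast hN
  have hpos : 0 < 1 + latNormSq n := by linarith [latNormSq_nonneg n]
  have h : (1 + latNormSq n) ^ (-τ) ≤ (N : ℝ) ^ (-(2 * τ)) := by
    have h2 : (N : ℝ) ^ (-(2 * τ)) = ((N : ℝ) ^ 2) ^ (-τ) := by
      rw [← Real.rpow_natCast, ← Real.rpow_mul hN'.le]
      congr 1
      push_cast
      ring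
    rw [h2]
    exact Real.rpow_le_rpow_of_nonpos (by positivity)
      (by linarith [sq_le_latNormSq_of_lt_supNorm hn]) (by linarith)
  unfold sobWeight
  rw [sub_eq_neg_add, Real.rpow_add hpos]
  gcongr

theorem summable_of_support_supNorm_le {d N : ℕ} {f : (Fin d → ℤ) → ℝ}
    (hf : ∀ n, N < supNorm n → f n = 0) : Summable f :=
  summable_of_hasFiniteSupport ((finite_setOf_supNorm_le d N).subset fun n hn => by
    by_contra h
    exact hn (hf n (not_le.1 h)))

/-- Squared `(s - τ)`-distance between a trigonometric polynomial of degree `N` and a spectrum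
in the `s`-ball of squared radius `B`, both within squared distance `q` of `g` up to degree `N`. -/
theorem tsum_sobWeight_sub_sq_le {d N : ℕ} (hN : 1 ≤ N) {s τ q B : ℝ} (hτ : 0 ≤ τ)
    {g u v : (Fin d → ℤ) → ℝ}
    (hgu : ∑' n : {n : Fin d → ℤ // supNorm n ≤ N},
      sobWeight (s - τ) n.1 * (g n.1 - u n.1) ^ 2 ≤ q)
    (hgv : ∑' n : {n : Fin d → ℤ // supNorm n ≤ N},
      sobWeight (s - τ) n.1 * (g n.1 - v n.1) ^ 2 ≤ q)
    (hv : ∀ n, N < supNorm n → v n = 0)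
    (hu : Summable fun n : Fin d → ℤ => sobWeight s n * u n ^ 2)
    (huB : ∑' n : Fin d → ℤ, sobWeight s n * u n ^ 2 ≤ B) :
    ∑' n : Fin d → ℤ, sobWeight (s - τ) n * (v n - u n) ^ 2 ≤
      4 * q + B * (N : ℝ) ^ (-(2 * τ)) := by
  have hc : (0 : ℝ) ≤ (N : ℝ) ^ (-(2 * τ)) := by positivity
  set c := (N : ℝ) ^ (-(2 * τ))
  set S : Set (Fin d → ℤ) := {n | supNorm n ≤ N}
  have hind : ∀ f : (Fin d → ℤ) → ℝ, HasSum (S.indicator f)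
      (∑' n : {n : Fin d → ℤ // supNorm n ≤ N}, f n.1) := fun f => by
    have h : Summable (S.indicator f) := summable_of_support_supNorm_le (N := N) fun n hn =>
      Set.indicator_of_notMem (s := S) (fun h => absurd hn (not_lt.2 h)) f
    have := h.hasSum
    rwa [← tsum_subtype S f] at this
  have hsum := (((hind fun n => sobWeight (s - τ) n * (g n - u n) ^ 2).mul_left 2).add
    ((hind fun n => sobWeight (s - τ) n * (g n - v n) ^ 2).mul_left 2)).add (hu.hasSum.mul_left c)
  have hle : ∀ n, sobWeight (s - τ) n * (v n - u n) ^ 2 ≤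
      2 * S.indicator (fun n => sobWeight (s - τ) n * (g n - u n) ^ 2) n +
        2 * S.indicator (fun n => sobWeight (s - τ) n * (g n - v n) ^ 2) n +
        c * (sobWeight s n * u n ^ 2) := by
    intro n
    have hw := sobWeight_nonneg (s - τ) n
    by_cases hn : n ∈ S
    · rw [Set.indicator_of_mem hn, Set.indicator_of_mem hn]
      have h1 : 0 ≤ c * (sobWeight s n * u n ^ 2) :=
        mul_nonneg hc (mul_nonneg (sobWeight_nonneg s n) (sq_nonneg _))
      have h2 : (v n - u n) ^ 2 ≤ 2 * (g n - u n) ^ 2 + 2 * (g n - v n) ^ 2 := by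
        nlinarith [sq_nonneg ((g n - u n) + (g n - v n))]
      nlinarith [mul_le_mul_of_nonneg_left h2 hw]
    · rw [Set.indicator_of_notMem hn, Set.indicator_of_notMem hn]
      have hn' : N < supNorm n := not_le.1 hn
      have h := mul_le_mul_of_nonneg_right (sobWeight_sub_le_of_lt_supNorm hN s hτ hn')
        (sq_nonneg (u n))
      rw [hv n hn']
      linarith
  have hF := Summable.of_nonneg_of_le
    (fun n => mul_nonneg (sobWeight_nonneg (s - τ) n) (sq_nonneg (v n - u n))) hle hsum.summable
  have h := hasSum_le hle hF.hasSum hsum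
  have hB := mul_le_mul_of_nonneg_left huB hc
  linarith

/-- If every `F w i` is within `C` of `f w`, then the infimum over `w` of the suprema over `i`
is within `C` of the infimum of `f`. -/
theorem abs_iInf_iSup_sub_iInf_le {W ι : Type*} [Nonempty W] [Nonempty ι] {F : W → ι → ℝ}
    {f : W → ℝ} {C : ℝ} (hf : BddBelow (Set.range f)) (h : ∀ w i, |F w i - f w| ≤ C) :
    |(⨅ w, ⨆ i, F w i) - ⨅ w, f w| ≤ C := by
  have hle : ∀ w, ⨆ i, F w i ≤ f w + C := fun w =>
    ciSup_le fun i => by linarith [(abs_le.1 (h w i)).2]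
  have hge : ∀ w, f w - C ≤ ⨆ i, F w i := fun w => by
    obtain ⟨i⟩ := ‹Nonempty ι›
    have hb : BddAbove (Set.range (F w)) := ⟨f w + C, by
      rintro _ ⟨j, rfl⟩
      linarith [(abs_le.1 (h w j)).2]⟩
    linarith [(abs_le.1 (h w i)).1, le_ciSup hb i]
  have hlow : ∀ w, (⨅ w, f w) - C ≤ ⨆ i, F w i := fun w => by
    linarith [hge w, ciInf_le hf w]
  have hbd : BddBelow (Set.range fun w => ⨆ i, F w i) := ⟨(⨅ w, f w) - C, by
    rintro _ ⟨w, rfl⟩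
    exact hlow w⟩
  have h1 : (⨅ w, f w) - C ≤ ⨅ w, ⨆ i, F w i := le_ciInf hlow
  have h2 : (⨅ w, ⨆ i, F w i) - C ≤ ⨅ w, f w := le_ciInf fun w => by
    linarith [ciInf_le hbd w, hle w]
  exact abs_le.2 ⟨by linarith, by linarith⟩

/-- deterministic finite-projection suboptimality gap bound, where the
adversary ranges over the `N`-truncated conformal set `V`. -/
theorem finite_projection_gap (d : ℕ) (hd : 1 ≤ d) (s τ : ℝ) (hτ : 0 ≤ τ)
    (N : ℕ) (hN : 1 ≤ N) (q B L : ℝ) (hq : 0 ≤ q) (hB : 0 ≤ B) (hL : 0 ≤ L)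
    {W : Type*} [Nonempty W] (J : W → ((Fin d → ℤ) → ℝ) → ℝ)
    (hlip : ∀ (w : W) (u u' : (Fin d → ℤ) → ℝ),
      (Summable fun n : Fin d → ℤ => sobWeight (s - τ) n * u n ^ 2) →
      (Summable fun n : Fin d → ℤ => sobWeight (s - τ) n * u' n ^ 2) →
      |J w u - J w u'| ≤
        L * Real.sqrt (∑' n : Fin d → ℤ, sobWeight (s - τ) n * (u n - u' n) ^ 2))
    (hbdd : ∀ v : (Fin d → ℤ) → ℝ, BddBelow (Set.range fun w => J w v))
    (g u : (Fin d → ℤ) → ℝ)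
    (hg0 : ∀ n : Fin d → ℤ, N < supNorm n → g n = 0)
    (hscore : ∑' n : {n : Fin d → ℤ // supNorm n ≤ N},
        sobWeight (s - τ) n.1 * (g n.1 - u n.1) ^ 2 ≤ q)
    (husum : Summable fun n : Fin d → ℤ => sobWeight s n * u n ^ 2)
    (hubound : ∑' n : Fin d → ℤ, sobWeight s n * u n ^ 2 ≤ B)
    (V : Set ((Fin d → ℤ) → ℝ))
    (hV : V = {v : (Fin d → ℤ) → ℝ |
        (∀ n : Fin d → ℤ, N < supNorm n → v n = 0) ∧
        (∑' n : {n : Fin d → ℤ // supNorm n ≤ N},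
          sobWeight (s - τ) n.1 * (g n.1 - v n.1) ^ 2 ≤ q) ∧
        ∑' n : Fin d → ℤ, sobWeight s n * v n ^ 2 ≤ B}) :
    |(⨅ w : W, ⨆ v : V, J w v.1) - ⨅ w : W, J w u|
      ≤ L * Real.sqrt (4 * q + B * (N : ℝ) ^ (-(2 * τ))) := by
  subst hV
  have hu' : Summable fun n : Fin d → ℤ => sobWeight (s - τ) n * u n ^ 2 :=
    Summable.of_nonneg_of_le (fun n => mul_nonneg (sobWeight_nonneg _ n) (sq_nonneg _))
      (fun n => mul_le_mul_of_nonneg_right (sobWeight_sub_le s hτ n) (sq_nonneg _)) husum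
  set S : Set (Fin d → ℤ) := {n | supNorm n ≤ N}
  have htrunc : ∀ n, N < supNorm n → S.indicator u n = 0 := fun n hn =>
    Set.indicator_of_notMem (s := S) (fun h => absurd hn (not_lt.2 h)) u
  have hne : Nonempty {v : (Fin d → ℤ) → ℝ |
      (∀ n : Fin d → ℤ, N < supNorm n → v n = 0) ∧
      (∑' n : {n : Fin d → ℤ // supNorm n ≤ N},
        sobWeight (s - τ) n.1 * (g n.1 - v n.1) ^ 2 ≤ q) ∧
      ∑' n : Fin d → ℤ, sobWeight s n * v n ^ 2 ≤ B} := by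
    refine ⟨S.indicator u, htrunc, ?_, ?_⟩
    · refine le_of_eq_of_le (tsum_congr fun n => ?_) hscore
      rw [Set.indicator_of_mem (show n.1 ∈ S from n.2)]
    · refine le_trans (Summable.tsum_le_tsum (fun n => ?_)
        (summable_of_support_supNorm_le (N := N) fun n hn => by simp [htrunc n hn]) husum) hubound
      refine mul_le_mul_of_nonneg_left ?_ (sobWeight_nonneg s n)
      by_cases hn : n ∈ S
      · rw [Set.indicator_of_mem hn]
      · simp [Set.indicator_of_notMem hn, sq_nonneg]
  refine abs_iInf_iSup_sub_iInf_le (hbdd u) fun w v => ?_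
  obtain ⟨v, hv0, hvq, -⟩ := v
  refine (hlip w v u
    (summable_of_support_supNorm_le (N := N) fun n hn => by simp [hv0 n hn]) hu').trans ?_
  exact mul_le_mul_of_nonneg_left
    (Real.sqrt_le_sqrt (tsum_sobWeight_sub_sq_le hN hτ hscore hvq hv0 husum hubound)) hL
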